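/- There exists a constant λ ∈ (0,1) such that for every integer s ∈ {1,…,b+1}, min_{t ∈ I} G(t,s) ≥ λ·G(s+α−1,s), where I := { t = α−1+k : k ∈ {0,…,b+1}, (b+α)/4 ≤ t ≤ 3(b+α)/4 }; moreover min_{t ∈ I} G(t,s) ≥ λ·max_{t ∈ {α−1,…,α+b}} G(t,s) for every such s. -/

import Mathlib

/-- Falling power `x^[y] = Γ(x+1)/Γ(x-y+1)`; it equals 0 when `x-y+1` is a
nonpositive integer since `Real.Gamma` vanishes there (and division by zero is zero). -/
noncomputable def fp (x y : ℝ) : ℝ := Real.Gamma (x + 1) / Real.Gamma (x - y + 1)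

/-- The Green function `G(t,s)` of the discrete fractional boundary value problem,
for `t ∈ T_b` (a real number) and an integer `s ∈ {0,1,…,b+1}`. -/
noncomputable def G (α : ℝ) (b : ℕ) (t : ℝ) (s : ℕ) : ℝ :=
  if (s : ℝ) ≤ t - α + 1 then
    1 / Real.Gamma α *
      (fp t (α - 1) * fp (α + b - s) (α - 1) / fp (α + b + 1) (α - 1) - fp (t - s - 1) (α - 1))
  else
    1 / Real.Gamma α * (fp t (α - 1) * fp (α + b - s) (α - 1) / fp (α + b + 1) (α - 1))

open Filter Topology

noncomputable def hh (α : ℝ) (n : ℕ) : ℝ := Real.Gamma (α + n) / Real.Gamma (n + 1)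

lemma fp_eq_hh (α x : ℝ) (n : ℕ) (hx : x = α - 1 + n) : fp x (α - 1) = hh α n := by
  subst hx
  unfold fp hh
  congr 2 <;> ring

lemma hh_pos (α : ℝ) (hα : 1 < α) (n : ℕ) : 0 < hh α n := by
  unfold hh
  have hn : (0 : ℝ) ≤ n := Nat.cast_nonneg n
  exact div_pos (Real.Gamma_pos_of_pos (by linarith)) (Real.Gamma_pos_of_pos (by linarith))

lemma hh_succ (α : ℝ) (hα : 1 < α) (n : ℕ) :
    hh α (n + 1) = (α + n) / (n + 1) * hh α n := by
  unfold hh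
  have hn : (0 : ℝ) ≤ n := Nat.cast_nonneg n
  have h1 : Real.Gamma (α + ((n + 1 : ℕ) : ℝ)) = (α + n) * Real.Gamma (α + n) := by
    rw [← Real.Gamma_add_one (by linarith)]
    congr 1
    push_cast
    ring
  have h2 : Real.Gamma (((n + 1 : ℕ) : ℝ) + 1) = (n + 1) * Real.Gamma (n + 1) := by
    rw [← Real.Gamma_add_one (by linarith)]
    congr 1
    push_cast
    ring
  have h3 : Real.Gamma ((n : ℝ) + 1) ≠ 0 := (Real.Gamma_pos_of_pos (by linarith)).ne'
  have h4 : (n : ℝ) + 1 ≠ 0 := by linarith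
  rw [h1, h2]
  field_simp

lemma hh_step (α : ℝ) (hα : 1 < α) (m k d : ℕ) (hmk : m < k)
    (h : hh α (k + d) * hh α m ≤ hh α (m + d) * hh α k) :
    hh α (k + (d + 1)) * hh α m < hh α (m + (d + 1)) * hh α k := by
  rw [← add_assoc, ← add_assoc, hh_succ α hα, hh_succ α hα, mul_assoc, mul_assoc]
  have hp : 0 < hh α (m + d) * hh α k := mul_pos (hh_pos α hα _) (hh_pos α hα _)
  have hmk' : (m : ℝ) < k := by exact_mod_cast hmk
  have hm : (0 : ℝ) ≤ m := Nat.cast_nonneg m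
  have hd : (0 : ℝ) ≤ d := Nat.cast_nonneg d
  have hr : (α + ((k + d : ℕ) : ℝ)) / (((k + d : ℕ) : ℝ) + 1)
      < (α + ((m + d : ℕ) : ℝ)) / (((m + d : ℕ) : ℝ) + 1) := by
    push_cast
    rw [div_lt_div_iff₀ (by linarith) (by linarith)]
    nlinarith
  have h0 : 0 ≤ (α + ((k + d : ℕ) : ℝ)) / (((k + d : ℕ) : ℝ) + 1) := by positivity
  exact lt_of_le_of_lt (mul_le_mul_of_nonneg_left h h0) (mul_lt_mul_of_pos_right hr hp)

lemma hh_lt (α : ℝ) (hα : 1 < α) (m k : ℕ) (hmk : m < k) (d : ℕ) :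
    hh α (k + (d + 1)) * hh α m < hh α (m + (d + 1)) * hh α k := by
  induction d with
  | zero => exact hh_step α hα m k 0 hmk (by simp [mul_comm])
  | succ d ih => exact hh_step α hα m k (d + 1) hmk ih.le

lemma G_pos (α : ℝ) (b : ℕ) (hα : 1 < α) (s k : ℕ) (hs : s ≤ b + 1)
    (hk : k ≤ b + 1) : 0 < G α b (α - 1 + k) s := by
  obtain ⟨c, hc⟩ := Nat.exists_eq_add_of_le hs
  have hc' : (b : ℝ) + 1 = s + c := by exact_mod_cast hc
  have e1 : fp (α - 1 + k) (α - 1) = hh α k := fp_eq_hh α _ k rfl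
  have e2 : fp (α + b - s) (α - 1) = hh α c := fp_eq_hh α _ c (by linarith)
  have e3 : fp (α + b + 1) (α - 1) = hh α (b + 2) :=
    fp_eq_hh α _ (b + 2) (by push_cast; ring)
  have p1 := hh_pos α hα k
  have p2 := hh_pos α hα c
  have p3 := hh_pos α hα (b + 2)
  have pg : 0 < 1 / Real.Gamma α := one_div_pos.mpr (Real.Gamma_pos_of_pos (by linarith))
  unfold G
  rw [e1, e2, e3]
  split_ifs with h
  · have hsk : s ≤ k := by
      have : (s : ℝ) ≤ k := by linarith
      exact_mod_cast this
    apply mul_pos pg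
    rcases hsk.eq_or_lt with heq | hlt
    · have : fp (α - 1 + k - s - 1) (α - 1) = 0 := by
        unfold fp
        have : α - 1 + (k : ℝ) - s - 1 - (α - 1) + 1 = 0 := by rw [heq]; ring
        rw [this, Real.Gamma_zero, div_zero]
      rw [this, sub_zero]
      positivity
    · obtain ⟨m, hm⟩ := Nat.exists_eq_add_of_lt hlt
      obtain ⟨d, hd⟩ := Nat.exists_eq_add_of_le hk
      have e4 : fp (α - 1 + k - s - 1) (α - 1) = hh α m :=
        fp_eq_hh α _ m (by rw [hm]; push_cast; ring)
      have key := hh_lt α hα m k (by omega) d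
      rw [show k + (d + 1) = b + 2 by omega, show m + (d + 1) = c by omega] at key
      rw [e4, sub_pos, lt_div_iff₀ p3]
      linarith
  · positivity

/-- There is a constant `λ ∈ (0,1)` such that for every integer `s ∈ {1,…,b+1}`,
`min_{t ∈ I} G(t,s) ≥ λ·G(s+α-1,s)` where
`I = {α-1+k : k = 0,…,b+1, (b+α)/4 ≤ α-1+k ≤ 3(b+α)/4}`; moreover
`min_{t ∈ I} G(t,s) ≥ λ·max_{t ∈ {α-1,…,α+b}} G(t,s)`. -/
theorem statement6 (α : ℝ) (b : ℕ) (hα1 : 1 < α) (hα2 : α ≤ 2) (hb : 2 ≤ b) :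
    ∃ lam : ℝ, lam ∈ Set.Ioo (0 : ℝ) 1 ∧
      ∀ s : ℕ, 1 ≤ s → s ≤ b + 1 →
        (∀ k : ℕ, k ≤ b + 1 → (b + α) / 4 ≤ α - 1 + k → α - 1 + k ≤ 3 * (b + α) / 4 →
          lam * G α b ((s : ℝ) + α - 1) s ≤ G α b (α - 1 + k) s) ∧
        (∀ k : ℕ, k ≤ b + 1 → (b + α) / 4 ≤ α - 1 + k → α - 1 + k ≤ 3 * (b + α) / 4 →
          ∀ k' : ℕ, k' ≤ b + 1 →
            lam * G α b (α - 1 + k') s ≤ G α b (α - 1 + k) s) := by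
  have ev : ∀ s ∈ Finset.range (b + 2), ∀ k ∈ Finset.range (b + 2),
      ∀ k' ∈ Finset.range (b + 2), ∀ᶠ lam : ℝ in 𝓝[>] 0,
        lam * G α b (α - 1 + k') s ≤ G α b (α - 1 + k) s := by
    intro s hs k hk k' _
    have hp := G_pos α b hα1 s k (by simp at hs; omega) (by simp at hk; omega)
    have ht : Tendsto (fun lam : ℝ => lam * G α b (α - 1 + k') s) (𝓝[>] 0) (𝓝 0) := by
      have : Tendsto (fun lam : ℝ => lam * G α b (α - 1 + k') s) (𝓝 0)
          (𝓝 (0 * G α b (α - 1 + k') s)) := tendsto_id.mul_const _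
      rw [zero_mul] at this
      exact this.mono_left nhdsWithin_le_nhds
    exact (ht.eventually_lt_const hp).mono fun _ h => h.le
  have ev2 : ∀ᶠ lam : ℝ in 𝓝[>] 0, ∀ s ∈ Finset.range (b + 2), ∀ k ∈ Finset.range (b + 2),
      ∀ k' ∈ Finset.range (b + 2),
        lam * G α b (α - 1 + k') s ≤ G α b (α - 1 + k) s := by
    rw [Filter.eventually_all_finset]
    intro s hs
    rw [Filter.eventually_all_finset]
    intro k hk
    rw [Filter.eventually_all_finset]
    exact ev s hs k hk
  obtain ⟨lam, h, hl⟩ := (ev2.and (Ioo_mem_nhdsGT (zero_lt_one (α := ℝ)))).exists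
  refine ⟨lam, hl, fun s _ hs => ⟨fun k hk _ _ => ?_, fun k hk _ _ k' hk' => ?_⟩⟩
  · have := h s (by simp; omega) k (by simp; omega) s (by simp; omega)
    rwa [show (s : ℝ) + α - 1 = α - 1 + s by ring]
  · exact h s (by simp; omega) k (by simp; omega) k' (by simp; omega)
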